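/- If σ is a non-zero simplicial cone, then its local Poincaré polynomial is P_σ ≡ 1, i.e., Ē•_σ is one-dimensional, concentrated in degree 0. -/

import Mathlib

open Module Function

set_option synthInstance.maxHeartbeats 1000000
set_option maxHeartbeats 1000000
set_option maxSynthPendingDepth 3

noncomputable section

/-! ## Cones and fans -/

/-- The convex cone generated by a finite set of vectors. -/
def coneGen {V : Type} [AddCommGroup V] [Module ℝ V] (s : Finset V) : Set V :=
  { x | ∃ c : V → ℝ, (∀ v ∈ s, 0 ≤ c v) ∧ x = ∑ v ∈ s, c v • v }

/-- A (strictly convex, i.e. pointed) polyhedral cone in a real vector space. -/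
structure Cone (V : Type) [AddCommGroup V] [Module ℝ V] where
  carrier : Set V
  isPoly : ∃ s : Finset V, carrier = coneGen s
  pointed : ∀ x ∈ carrier, -x ∈ carrier → x = 0

namespace Cone

variable {V : Type} [AddCommGroup V] [Module ℝ V]

/-- The linear span `V_σ` of a cone. -/
def spanC (σ : Cone V) : Submodule ℝ V := Submodule.span ℝ σ.carrier

/-- The dimension of a cone. -/
def dim (σ : Cone V) : ℕ := Module.finrank ℝ σ.spanC

/-- `τ` is a face of `σ` (cut out by a supporting linear form); `σ` is a face of itself. -/
def IsFaceOf (τ σ : Cone V) : Prop :=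
  ∃ f : V →ₗ[ℝ] ℝ, (∀ x ∈ σ.carrier, 0 ≤ f x) ∧
    τ.carrier = σ.carrier ∩ {x | f x = 0}

def IsProperFaceOf (τ σ : Cone V) : Prop := τ.IsFaceOf σ ∧ τ ≠ σ

/-- A cone is simplicial if it is generated by linearly independent vectors. -/
def IsSimplicial (σ : Cone V) : Prop :=
  ∃ s : Finset V, (LinearIndependent ℝ (fun v : s => (v : V))) ∧ σ.carrier = coneGen s

end Cone

/-- The zero cone `o`. -/
def zeroCone (V : Type) [AddCommGroup V] [Module ℝ V] : Cone V where
  carrier := {0}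
  isPoly := ⟨∅, by ext x; simp [coneGen]⟩
  pointed := by intro x hx _; simpa using hx

/-- A fan in `V`: a finite collection of pointed polyhedral cones, closed under taking
faces, such that the intersection of any two cones is a common face of both. -/
structure Fan (V : Type) [AddCommGroup V] [Module ℝ V] where
  cones : Set (Cone V)
  finite : cones.Finite
  zero_mem : zeroCone V ∈ cones
  face_mem : ∀ σ ∈ cones, ∀ τ : Cone V, τ.IsFaceOf σ → τ ∈ cones
  inter_mem : ∀ σ ∈ cones, ∀ σ' ∈ cones, ∃ τ ∈ cones,
    τ.IsFaceOf σ ∧ τ.IsFaceOf σ' ∧ τ.carrier = σ.carrier ∩ σ'.carrier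

namespace Fan

variable {V : Type} [AddCommGroup V] [Module ℝ V]

/-- A subfan of `Δ`: a subset of the cones closed under taking faces.  The subfans are
exactly the open subsets of the fan topology. -/
def IsSubfan (Δ : Fan V) (Λ : Set (Cone V)) : Prop :=
  Λ ⊆ Δ.cones ∧ ∀ σ ∈ Λ, ∀ τ : Cone V, τ.IsFaceOf σ → τ ∈ Λ

/-- The support `|Δ|` of a fan. -/
def support (Δ : Fan V) : Set V := ⋃ σ ∈ Δ.cones, σ.carrier

/-- A fan is complete if its support is the whole space. -/
def IsComplete (Δ : Fan V) : Prop := Δ.support = Set.univ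

/-- A fan is simplicial if all its cones are. -/
def IsSimplicial (Δ : Fan V) : Prop := ∀ σ ∈ Δ.cones, σ.IsSimplicial

/-- A fan is purely `n`-dimensional if every cone is a face of an `n`-dimensional cone. -/
def IsPurely (Δ : Fan V) (n : ℕ) : Prop :=
  ∀ σ ∈ Δ.cones, ∃ σ' ∈ Δ.cones, σ.IsFaceOf σ' ∧ σ'.dim = n

/-- The boundary subfan `∂Δ`: the cones supported in the topological boundary of `|Δ|`. -/
def boundary [TopologicalSpace V] (Δ : Fan V) : Set (Cone V) :=
  {τ ∈ Δ.cones | τ.carrier ⊆ frontier Δ.support}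

end Fan

/-! ## The graded algebra `A•` of polynomial functions (linear forms in degree 2) -/

/-- The algebra of polynomial functions on `V`, i.e. the subalgebra of `V → ℝ`
generated by the linear forms. -/
def polyAlg (V : Type) [AddCommGroup V] [Module ℝ V] : Subalgebra ℝ (V → ℝ) :=
  Algebra.adjoin ℝ {f : V → ℝ | IsLinearMap ℝ f}

/-- `A• = S•(V*)` as a commutative ring. -/
abbrev PolyRing (V : Type) [AddCommGroup V] [Module ℝ V] : Type := polyAlg V

variable (V : Type) [AddCommGroup V] [Module ℝ V]

/-- Polynomial functions homogeneous of (topological) degree `2k`. -/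
def AdegN (k : ℕ) : Submodule ℝ (PolyRing V) where
  carrier := {f | ∀ (t : ℝ) (x : V), (f : V → ℝ) (t • x) = t ^ k * (f : V → ℝ) x}
  add_mem' := by intro f g hf hg t x; simp [hf t x, hg t x]; ring
  zero_mem' := by intro t x; simp
  smul_mem' := by intro c f hf t x; simp [hf t x]; ring

/-- The degree-`q` part `A^q` of `A•`, with linear forms in degree `2`
(so `A^q = 0` for odd `q`). -/
def Adeg (q : ℤ) : Submodule ℝ (PolyRing V) :=
  ⨆ (k : ℕ) (_ : q = 2 * k), AdegN V k

/-- Evaluation of a polynomial function at a point, as a ring homomorphism. -/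
def evalRH (x : V) : PolyRing V →+* ℝ :=
  (Pi.evalRingHom (fun _ : V => ℝ) x).comp (polyAlg V).val.toRingHom

/-- The maximal graded ideal `m = A^{>0}` of polynomial functions vanishing at the origin. -/
def mId : Ideal (PolyRing V) := RingHom.ker (evalRH V 0)

/-- The ideal of polynomial functions vanishing on a subset `s ⊆ V`;
for `s = σ` a cone, `A•/I(σ) = A•_σ = S•(V_σ*)`. -/
def vanishingIdeal (s : Set V) : Ideal (PolyRing V) :=
  RingHom.ker (Pi.ringHom (fun x : s => evalRH V x.1))

/-- `A•_σ`, realized as the quotient of `A•` by the functions vanishing on `σ`. -/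
abbrev coneRing (σ : Cone V) : Type := PolyRing V ⧸ vanishingIdeal V σ.carrier

/-! ## Graded `A•`-modules -/

/-- A graded `A•`-module (with real structure): an `A•`-module with an internal
`ℤ`-grading by real subspaces, compatible with the grading of `A•`. -/
structure GAMod where
  M : Type
  [acg : AddCommGroup M]
  [modA : Module (PolyRing V) M]
  [modR : Module ℝ M]
  [tower : IsScalarTower ℝ (PolyRing V) M]
  deg : ℤ → Submodule ℝ M
  internal : DirectSum.IsInternal deg
  smul_deg : ∀ (p q : ℤ), ∀ a ∈ Adeg V p, ∀ x ∈ deg q, a • x ∈ deg (p + q)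

attribute [instance] GAMod.acg GAMod.modA GAMod.modR GAMod.tower

variable {V}

/-- A homomorphism of graded `A•`-modules, homogeneous of degree 0. -/
structure GHom (M N : GAMod V) where
  toLin : M.M →ₗ[PolyRing V] N.M
  deg_mem : ∀ q : ℤ, ∀ x ∈ M.deg q, toLin x ∈ N.deg q

def GHom.id (M : GAMod V) : GHom M M := ⟨LinearMap.id, fun _ _ h => h⟩

def GHom.comp {M N P : GAMod V} (g : GHom N P) (f : GHom M N) : GHom M P :=
  ⟨g.toLin ∘ₗ f.toLin, fun q x hx => g.deg_mem q _ (f.deg_mem q x hx)⟩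

variable (V)

/-- `M` is (the `A•`-module underlying) a free `A•_σ`-module. -/
def FreeOverCone (σ : Cone V) (M : Type) [AddCommGroup M] [Module (PolyRing V) M] : Prop :=
  ∃ h : Module.IsTorsionBySet (PolyRing V) M (vanishingIdeal V σ.carrier),
    letI := h.module
    Module.Free (coneRing V σ) M

/-! ## Reduction modulo the maximal graded ideal -/

/-- The submodule `m·M`. -/
def mSub (M : Type) [AddCommGroup M] [Module (PolyRing V) M] :
    Submodule (PolyRing V) M := (mId V) • (⊤ : Submodule (PolyRing V) M)

/-- The reduction `M̄ = M/mM`. -/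
abbrev mRed (M : Type) [AddCommGroup M] [Module (PolyRing V) M] : Type := M ⧸ mSub V M

lemma mSub_le_comap {M N : Type} [AddCommGroup M] [Module (PolyRing V) M]
    [AddCommGroup N] [Module (PolyRing V) N] (f : M →ₗ[PolyRing V] N) :
    mSub V M ≤ (mSub V N).comap f := by
  rw [mSub, Submodule.smul_le]
  intro r hr x _
  simp only [Submodule.mem_comap, map_smul]
  exact Submodule.smul_mem_smul hr trivial

/-- The reduced map `M̄ → N̄` induced by an `A•`-linear map. -/
def mRedMap {M N : Type} [AddCommGroup M] [Module (PolyRing V) M]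
    [AddCommGroup N] [Module (PolyRing V) N] (f : M →ₗ[PolyRing V] N) :
    mRed V M →ₗ[PolyRing V] mRed V N :=
  Submodule.mapQ _ _ f (mSub_le_comap V f)

/-- The image in `M̄` of an `ℝ`-subspace of `M` (e.g. of a graded piece). -/
def mRedPiece {M : Type} [AddCommGroup M] [Module (PolyRing V) M] [Module ℝ M]
    [IsScalarTower ℝ (PolyRing V) M] (p : Submodule ℝ M) : Submodule ℝ (mRed V M) :=
  p.map ((mSub V M).mkQ.restrictScalars ℝ)

/-! ## Sheaves of graded `A•`-modules on a fan -/

open scoped Classical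

/-- The zero cone as an element of a fan. -/
def Fan.ozero {V : Type} [AddCommGroup V] [Module ℝ V] (Δ : Fan V) : Δ.cones :=
  ⟨zeroCone V, Δ.zero_mem⟩


variable {V}

/-- A sheaf of graded `A•`-modules on the fan space `Δ`, given (as the fan topology
dictates) by its stalks on the cones together with compatible restriction maps. -/
structure FanSheaf (Δ : Fan V) where
  stalk : Δ.cones → GAMod V
  res : ∀ σ τ : Δ.cones, Cone.IsFaceOf τ.1 σ.1 → GHom (stalk σ) (stalk τ)
  res_self : ∀ (σ : Δ.cones) (h : Cone.IsFaceOf σ.1 σ.1), (res σ σ h).toLin = LinearMap.id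
  res_comp : ∀ (σ τ υ : Δ.cones) (h1 : Cone.IsFaceOf τ.1 σ.1) (h2 : Cone.IsFaceOf υ.1 τ.1)
      (h3 : Cone.IsFaceOf υ.1 σ.1),
      (res τ υ h2).toLin ∘ₗ (res σ τ h1).toLin = (res σ υ h3).toLin

namespace FanSheaf

variable {Δ : Fan V} (F : FanSheaf Δ)

/-- The sections of `F` over a collection `Λ` of cones of `Δ` (e.g. a subfan):
compatible families of elements of the stalks over `Λ`, extended by zero. -/
def secSub (Λ : Set (Cone V)) :
    Submodule (PolyRing V) (∀ σ : Δ.cones, (F.stalk σ).M) where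
  carrier := { s | (∀ σ : Δ.cones, σ.1 ∉ Λ → s σ = 0) ∧
    ∀ (σ τ : Δ.cones), σ.1 ∈ Λ → τ.1 ∈ Λ → ∀ h : Cone.IsFaceOf τ.1 σ.1,
      (F.res σ τ h).toLin (s σ) = s τ }
  add_mem' := by
    rintro a b ⟨ha0, ha⟩ ⟨hb0, hb⟩
    refine ⟨fun σ hσ => by simp [ha0 σ hσ, hb0 σ hσ], fun σ τ hσ hτ h => ?_⟩
    simp [map_add, ha σ τ hσ hτ h, hb σ τ hσ hτ h]
  zero_mem' := ⟨fun _ _ => rfl, fun σ τ _ _ h => by simp⟩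
  smul_mem' := by
    rintro c a ⟨ha0, ha⟩
    refine ⟨fun σ hσ => by simp [ha0 σ hσ], fun σ τ hσ hτ h => ?_⟩
    simp [map_smul, ha σ τ hσ hτ h]

/-- The `A•`-module of sections of `F` over `Λ`. -/
abbrev Sec (Λ : Set (Cone V)) : Type := F.secSub Λ

/-- The global sections `E•(Δ)`. -/
abbrev globalSec : Type := F.Sec Δ.cones

/-- The degree-`q` part of the module of sections. -/
def secDeg (Λ : Set (Cone V)) (q : ℤ) : Submodule ℝ (F.Sec Λ) where
  carrier := { s | ∀ σ : Δ.cones, s.1 σ ∈ (F.stalk σ).deg q }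
  add_mem' := by intro a b ha hb σ; exact add_mem (ha σ) (hb σ)
  zero_mem' := fun σ => zero_mem _
  smul_mem' := by intro c a ha σ; exact Submodule.smul_mem _ c (ha σ)

/-- Restriction of sections to a smaller collection of cones. -/
def resSec (Λ' Λ : Set (Cone V)) (hΛ : Λ ⊆ Λ') : F.Sec Λ' →ₗ[PolyRing V] F.Sec Λ where
  toFun s := ⟨fun σ => if σ.1 ∈ Λ then s.1 σ else 0, by
    classical
    refine ⟨fun σ hσ => by simp [hσ], fun σ τ hσ hτ h => ?_⟩
    simp only [hσ, hτ, if_pos]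
    exact s.2.2 σ τ (hΛ hσ) (hΛ hτ) h⟩
  map_add' a b := by
    apply Subtype.ext; funext σ; by_cases h : σ.1 ∈ Λ <;> simp [h]
  map_smul' c a := by
    apply Subtype.ext; funext σ; by_cases h : σ.1 ∈ Λ <;> simp [h]

/-- A sheaf is flabby if all restrictions from global sections to subfans are surjective. -/
def Flabby : Prop :=
  ∀ Λ : Set (Cone V), ∀ h : Δ.IsSubfan Λ, Function.Surjective (F.resSec Δ.cones Λ h.1)

/-- The boundary fan `∂σ` of a cone of `Δ`, as a set of cones. -/
def bdFan (σ : Δ.cones) : Set (Cone V) := {τ : Cone V | τ.IsProperFaceOf σ.1}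

/-- The restriction map `E•_σ → E•_{∂σ}` from the stalk to the sections over the
boundary fan of `σ`. -/
def bdRes (σ : Δ.cones) : (F.stalk σ).M →ₗ[PolyRing V] F.Sec (bdFan σ) where
  toFun x := ⟨fun τ => if h : Cone.IsProperFaceOf τ.1 σ.1 then (F.res σ τ h.1).toLin x else 0, by
    refine ⟨fun τ hτ => by simp [bdFan] at hτ; simp [hτ], ?_⟩
    intro τ υ hτ hυ h
    simp only [bdFan, Set.mem_setOf_eq] at hτ hυ
    simp only [dif_pos hτ, dif_pos hυ]
    rw [← F.res_comp σ τ υ hτ.1 h hυ.1]; rfl⟩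
  map_add' a b := by
    apply Subtype.ext; funext τ
    by_cases h : Cone.IsProperFaceOf τ.1 σ.1 <;> simp [h]
  map_smul' c a := by
    apply Subtype.ext; funext τ
    by_cases h : Cone.IsProperFaceOf τ.1 σ.1 <;> simp [h]

/-- The reduced restriction map `Ē•_σ → Ē•_{∂σ}` modulo `m`. -/
def bdResRed (σ : Δ.cones) :
    mRed V (F.stalk σ).M →ₗ[PolyRing V] mRed V (F.Sec (bdFan σ)) :=
  mRedMap V (F.bdRes σ)

/-- Condition (N): `E•_o ≅ A•_o = ℝ•`, i.e. the stalk at the zero cone is the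
trivial one-dimensional graded module concentrated in degree `0`. -/
def CondN : Prop :=
  Module.IsTorsionBySet (PolyRing V) (F.stalk Δ.ozero).M (mId V : Set (PolyRing V)) ∧
  Module.finrank ℝ (F.stalk Δ.ozero).M = 1 ∧
  ∀ q : ℤ, q ≠ 0 → (F.stalk Δ.ozero).deg q = ⊥

/-- Condition (PF): each stalk `E•_σ` is a free `A•_σ`-module. -/
def CondPF : Prop := ∀ σ : Δ.cones, FreeOverCone V σ.1 (F.stalk σ).M

/-- Condition (LME): for each nonzero cone `σ`, the restriction `E•_σ → E•_{∂σ}`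
induces, modulo `m`, an isomorphism of graded real vector spaces. -/
def CondLME : Prop :=
  ∀ σ : Δ.cones, σ.1 ≠ zeroCone V → ∀ q : ℤ,
    Set.BijOn (F.bdResRed σ)
      (mRedPiece V ((F.stalk σ).deg q) : Set (mRed V (F.stalk σ).M))
      (mRedPiece V (M := F.Sec (bdFan σ)) (F.secDeg (bdFan σ) q) : Set (mRed V (F.Sec (bdFan σ))))

/-- A minimal extension sheaf on the fan `Δ`. -/
def IsMES : Prop := F.CondN ∧ F.CondPF ∧ F.CondLME

end FanSheaf

/-! ## Quasi-convexity, boundary sections, and Poincaré polynomials -/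

section

variable {V : Type} [AddCommGroup V] [Module ℝ V]

/-- A fan is quasi-convex if the global sections of a minimal extension sheaf on it
form a free `A•`-module. -/
def Fan.QuasiConvex (Δ : Fan V) : Prop :=
  ∀ F : FanSheaf Δ, F.IsMES → Module.Free (PolyRing V) F.globalSec

lemma Fan.boundary_subset [TopologicalSpace V] (Δ : Fan V) : Δ.boundary ⊆ Δ.cones :=
  fun _ h => h.1

/-- The module `E•_{(Δ,∂Δ)}` of global sections vanishing on the boundary subfan. -/
def FanSheaf.relSec [TopologicalSpace V] {Δ : Fan V} (F : FanSheaf Δ) :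
    Submodule (PolyRing V) F.globalSec :=
  LinearMap.ker (F.resSec Δ.cones Δ.boundary (Fan.boundary_subset Δ))

/-- The degree-`q` part of `E•_{(Δ,∂Δ)}`. -/
def FanSheaf.relDeg [TopologicalSpace V] {Δ : Fan V} (F : FanSheaf Δ) (q : ℤ) :
    Submodule ℝ F.relSec :=
  (F.secDeg Δ.cones q).comap ((F.relSec.subtype).restrictScalars ℝ)

/-- The polynomial `Σ_q d(q)·t^q` associated with a (finitely supported) dimension
function. -/
def poincareOf (d : ℕ → ℕ) : Polynomial ℝ :=
  if h : (Function.support d).Finite then ∑ q ∈ h.toFinset, (d q : ℝ) • Polynomial.X ^ q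
  else 0

/-- The local Poincaré polynomial `P_σ(t) = Σ_q dim Ē^q_σ · t^q`. -/
def FanSheaf.localP {Δ : Fan V} (F : FanSheaf Δ) (σ : Δ.cones) : Polynomial ℝ :=
  poincareOf fun q => Module.finrank ℝ (mRedPiece V ((F.stalk σ).deg q))

/-- The global Poincaré polynomial `P_Δ(t) = Σ_q dim Ē^q_Δ · t^q`. -/
def FanSheaf.globalP {Δ : Fan V} (F : FanSheaf Δ) : Polynomial ℝ :=
  poincareOf fun q =>
    Module.finrank ℝ (mRedPiece V (M := F.globalSec) (F.secDeg Δ.cones q))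

/-- The relative Poincaré polynomial `P_{(Δ,∂Δ)}(t)`. -/
def FanSheaf.relP [TopologicalSpace V] {Δ : Fan V} (F : FanSheaf Δ) : Polynomial ℝ :=
  poincareOf fun q =>
    Module.finrank ℝ (mRedPiece V (M := F.relSec) (F.relDeg q))

end

/-! ## Auxiliary material for the proof -/

section Aux

variable {V : Type} [AddCommGroup V] [Module ℝ V]

lemma aux_mem_vanishing {s : Set V} {a : PolyRing V} :
    a ∈ vanishingIdeal V s ↔ ∀ x ∈ s, a.1 x = 0 := by
  rw [vanishingIdeal, RingHom.mem_ker, funext_iff]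
  constructor
  · intro h x hx
    exact h ⟨x, hx⟩
  · intro h x
    exact h x.1 x.2

lemma aux_mem_mId {a : PolyRing V} : a ∈ mId V ↔ a.1 0 = 0 := Iff.rfl

/-- Polynomial functions without constant term. -/
def auxPos (V : Type) [AddCommGroup V] [Module ℝ V] : Submodule ℝ (PolyRing V) :=
  ⨆ k : ℕ, AdegN V (k + 1)

lemma aux_pos_mul {a b : PolyRing V} (ha : a ∈ auxPos V) (hb : b ∈ auxPos V) :
    a * b ∈ auxPos V := by
  unfold auxPos at ha
  induction ha using Submodule.iSup_induction' with
  | mem i x hx =>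
    unfold auxPos at hb
    induction hb using Submodule.iSup_induction' with
    | mem j y hy =>
      refine Submodule.mem_iSup_of_mem (i + 1 + j) ?_
      intro t v
      have h1 := hx t v
      have h2 := hy t v
      change x.1 (t • v) * y.1 (t • v) = t ^ (i + 1 + j + 1) * (x.1 v * y.1 v)
      rw [h1, h2]; ring
    | zero => rw [mul_zero]; exact zero_mem _
    | add y z _ _ h1 h2 => rw [mul_add]; exact add_mem h1 h2
  | zero => rw [zero_mul]; exact zero_mem _
  | add y z _ _ h1 h2 => rw [add_mul]; exact add_mem h1 h2

lemma aux_decomp (a : PolyRing V) :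
    ∃ w ∈ auxPos V, a = algebraMap ℝ (PolyRing V) (a.1 0) + w := by
  obtain ⟨f, hf⟩ := a
  unfold polyAlg at hf
  induction hf using Algebra.adjoin_induction with
  | mem f hf =>
    refine ⟨⟨f, Algebra.subset_adjoin hf⟩, ?_, ?_⟩
    · refine Submodule.mem_iSup_of_mem 0 ?_
      intro t x
      change f (t • x) = t ^ (0 + 1) * f x
      rw [hf.map_smul]; simp
    · have : f 0 = 0 := (IsLinearMap.mk' f hf).map_zero
      simp [this]
  | algebraMap r =>
    refine ⟨0, zero_mem _, ?_⟩
    apply Subtype.ext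
    funext x
    simp
  | add f g hf hg h1 h2 =>
    obtain ⟨u, hu, hu'⟩ := h1
    obtain ⟨v, hv, hv'⟩ := h2
    refine ⟨u + v, add_mem hu hv, ?_⟩
    have : (⟨f + g, add_mem hf hg⟩ : PolyRing V) = ⟨f, hf⟩ + ⟨g, hg⟩ := rfl
    rw [this]
    rw [hu', hv']
    have e1 := congrArg (fun z : PolyRing V => z.1 0) hu'
    have e2 := congrArg (fun z : PolyRing V => z.1 0) hv'
    simp at e1 e2
    simp [e1, e2]
    ring
  | mul f g hf hg h1 h2 =>
    obtain ⟨u, hu, hu'⟩ := h1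
    obtain ⟨v, hv, hv'⟩ := h2
    refine ⟨u * v + (f 0) • v + (g 0) • u, add_mem (add_mem (aux_pos_mul hu hv)
      (Submodule.smul_mem _ _ hv)) (Submodule.smul_mem _ _ hu), ?_⟩
    have : (⟨f * g, mul_mem hf hg⟩ : PolyRing V) = ⟨f, hf⟩ * ⟨g, hg⟩ := rfl
    rw [this]
    have e3 : ((⟨f, hf⟩ * ⟨g, hg⟩ : PolyRing V)).1 0 = f 0 * g 0 := rfl
    rw [e3, hu', hv', map_mul, Algebra.smul_def, Algebra.smul_def]
    change (algebraMap ℝ (PolyRing V) (f 0) + u) * (algebraMap ℝ (PolyRing V) (g 0) + v) = _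
    ring

lemma aux_comp (a : PolyRing V) (L : V →ₗ[ℝ] V) :
    ∃ b : PolyRing V, ∀ x, b.1 x = a.1 (L x) := by
  obtain ⟨f, hf⟩ := a
  unfold polyAlg at hf
  induction hf using Algebra.adjoin_induction with
  | mem f hf =>
    exact ⟨⟨f ∘ L, Algebra.subset_adjoin
      (LinearMap.isLinear ((IsLinearMap.mk' f hf).comp L))⟩, fun x => rfl⟩
  | algebraMap r => exact ⟨algebraMap ℝ _ r, fun x => rfl⟩
  | add f g hf hg h1 h2 =>
    obtain ⟨u, hu⟩ := h1
    obtain ⟨v, hv⟩ := h2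
    exact ⟨u + v, fun x => congrArg₂ (· + ·) (hu x) (hv x)⟩
  | mul f g hf hg h1 h2 =>
    obtain ⟨u, hu⟩ := h1
    obtain ⟨v, hv⟩ := h2
    exact ⟨u * v, fun x => congrArg₂ (· * ·) (hu x) (hv x)⟩

/-! ### linear algebra of simplicial cones -/

lemma aux_exists_lin {W : Type} [AddCommGroup W] [Module ℝ W] {s : Finset V}
    (hs : LinearIndependent ℝ (fun v : s => (v : V))) (g : V → W) :
    ∃ L : V →ₗ[ℝ] W, ∀ v ∈ s, L v = g v := by
  have hs' : LinearIndepOn ℝ id (s : Set V) := hs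
  refine ⟨(Basis.extend hs').constr ℝ (fun v => g v), fun v hv => ?_⟩
  have := (Basis.extend hs').constr_basis ℝ (fun v => g v)
    ⟨v, hs'.subset_extend _ hv⟩
  simpa using this

lemma aux_li_mono {s t : Finset V} (h : t ⊆ s)
    (hs : LinearIndependent ℝ (fun v : s => (v : V))) :
    LinearIndependent ℝ (fun v : t => (v : V)) := by
  have hs' : LinearIndepOn ℝ id (s : Set V) := hs
  exact hs'.mono (by exact_mod_cast h)

lemma aux_coneGen_mono {s t : Finset V} (h : t ⊆ s) : coneGen t ⊆ coneGen s := by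
  rintro x ⟨c, hc, rfl⟩
  refine ⟨fun v => if v ∈ t then c v else 0, fun v _ => ?_, ?_⟩
  · by_cases hv : v ∈ t
    · simp [hv, hc v hv]
    · simp [hv]
  · simp only [ite_smul, zero_smul]
    rw [Finset.sum_ite_mem, Finset.inter_eq_right.mpr h]

lemma aux_mem_coneGen {s : Finset V} {v : V} (h : v ∈ s) : v ∈ coneGen s := by
  refine ⟨fun w => if w = v then 1 else 0, fun w _ => by dsimp only; split_ifs <;> simp, ?_⟩
  simp [ite_smul, h]

lemma aux_zero_mem (s : Finset V) : (0 : V) ∈ coneGen s :=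
  ⟨fun _ => 0, fun _ _ => le_rfl, by simp⟩

/-- faces cut out by a nonnegative functional -/
lemma aux_face {s : Finset V} (f : V →ₗ[ℝ] ℝ) (hf : ∀ x ∈ coneGen s, 0 ≤ f x) :
    coneGen s ∩ {x | f x = 0} = coneGen (s.filter fun v => f v = 0) := by
  ext x
  constructor
  · rintro ⟨⟨c, hc, rfl⟩, h0⟩
    refine ⟨c, fun v hv => hc v (Finset.mem_filter.mp hv).1, ?_⟩
    simp only [Set.mem_setOf_eq, map_sum, map_smul, smul_eq_mul] at h0
    rw [Finset.sum_eq_zero_iff_of_nonneg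
      (fun v hv => mul_nonneg (hc v hv) (hf v (aux_mem_coneGen hv)))] at h0
    rw [Finset.sum_filter]
    refine Finset.sum_congr rfl fun v hv => ?_
    split_ifs with h
    · rfl
    · have := h0 v hv
      simp [h] at this
      simp [this]
  · intro hx
    refine ⟨aux_coneGen_mono (Finset.filter_subset _ _) hx, ?_⟩
    obtain ⟨c, hc, rfl⟩ := hx
    simp only [Set.mem_setOf_eq, map_sum, map_smul, smul_eq_mul]
    refine Finset.sum_eq_zero fun v hv => ?_
    rw [(Finset.mem_filter.mp hv).2, mul_zero]

lemma aux_cone_ext {σ τ : Cone V} (h : σ.carrier = τ.carrier) : σ = τ := by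
  cases σ; cases τ; simp at h; subst h; rfl

lemma aux_subset_face {s t : Finset V} (h : t ⊆ s)
    (hs : LinearIndependent ℝ (fun v : s => (v : V)))
    {σ τ : Cone V} (hσ : σ.carrier = coneGen s) (hτ : τ.carrier = coneGen t) :
    τ.IsFaceOf σ := by
  obtain ⟨f, hf⟩ := aux_exists_lin hs (fun v => if v ∈ t then (0 : ℝ) else 1)
  have hpos : ∀ x ∈ coneGen s, 0 ≤ f x := by
    rintro x ⟨c, hc, rfl⟩
    rw [map_sum]
    refine Finset.sum_nonneg fun v hv => ?_
    rw [map_smul, hf v hv]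
    have := hc v hv
    split_ifs <;> simp [this]
  refine ⟨f, by rwa [hσ], ?_⟩
  rw [hσ, hτ, aux_face f hpos]
  congr 1
  ext v
  simp only [Finset.mem_filter]
  constructor
  · intro hv
    exact ⟨h hv, by rw [hf v (h hv)]; simp [hv]⟩
  · rintro ⟨hv, h0⟩
    by_contra hvt
    rw [hf v hv] at h0
    simp [hvt] at h0

/-- subcone generated by a subset of the generators -/
def auxSub (σ : Cone V) (s t : Finset V) (hσ : σ.carrier = coneGen s) (h : t ⊆ s) : Cone V where
  carrier := coneGen t
  isPoly := ⟨t, rfl⟩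
  pointed := fun x hx hx' => σ.pointed x (hσ ▸ aux_coneGen_mono h hx)
    (hσ ▸ aux_coneGen_mono h hx')

/-- Extension of piecewise polynomial functions from the boundary of a simplicial cone. -/
lemma aux_extend {s : Finset V} (hs : LinearIndependent ℝ (fun v : s => (v : V)))
    (g : V → PolyRing V)
    (hg : ∀ v ∈ s, ∀ w ∈ s, ∀ x ∈ coneGen ((s.erase v).erase w), (g v).1 x = (g w).1 x)
    (t : Finset V) (ht : t ⊆ s) :
    ∃ a : PolyRing V, ∀ v ∈ t, ∀ x ∈ coneGen (s.erase v), a.1 x = (g v).1 x := by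
  induction t using Finset.induction_on with
  | empty => exact ⟨0, by simp⟩
  | insert w t hw ih =>
    obtain ⟨a, ha⟩ := ih (fun v hv => ht (Finset.mem_insert_of_mem hv))
    have hws : w ∈ s := ht (Finset.mem_insert_self _ _)
    obtain ⟨L, hL⟩ := aux_exists_lin hs (fun v => if v = w then (0 : V) else v)
    obtain ⟨b, hb⟩ := aux_comp (g w - a) L
    have hLmem : ∀ v, ∀ x ∈ coneGen (s.erase v), L x ∈ coneGen ((s.erase v).erase w) := by
      rintro v x ⟨c, hc, rfl⟩
      refine ⟨c, fun u hu => hc u (Finset.mem_of_mem_erase hu), ?_⟩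
      rw [map_sum, ← Finset.filter_ne' (s.erase v) w, Finset.sum_filter]
      refine Finset.sum_congr rfl fun u hu => ?_
      rw [map_smul, hL u (Finset.mem_of_mem_erase hu)]
      by_cases huw : u = w <;> simp [huw]
    refine ⟨a + b, fun v hv x hx => ?_⟩
    have hab : (a + b).1 x = a.1 x + ((g w).1 (L x) - a.1 (L x)) := by
      change a.1 x + b.1 x = _
      rw [hb]; rfl
    rw [hab]
    rcases Finset.mem_insert.mp hv with rfl | hvt
    · have : L x = x := by
        obtain ⟨c, hc, rfl⟩ := hx
        rw [map_sum]
        refine Finset.sum_congr rfl fun u hu => ?_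
        rw [map_smul, hL u (Finset.mem_of_mem_erase hu)]
        simp [Finset.ne_of_mem_erase hu]
      rw [this]; ring
    · have h1 := hLmem v x hx
      have h2 := ha v hvt _ (aux_coneGen_mono (Finset.erase_subset _ _) h1)
      have h3 := hg v (ht hv) w hws _ h1
      rw [ha v hvt x hx, h2, h3]; ring

/-! ### graded modules -/

/-- the decomposition isomorphism of a graded module -/
def auxEquiv (M : GAMod V) : (DirectSum ℤ fun i => M.deg i) ≃ₗ[ℝ] M.M :=
  LinearEquiv.ofBijective (DirectSum.coeLinearMap M.deg)
    (show Function.Bijective (DirectSum.coeLinearMap M.deg) from M.internal)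

/-- projection of a graded module to its degree-`j` component -/
def auxProj (M : GAMod V) (j : ℤ) : M.M →ₗ[ℝ] M.M :=
  (M.deg j).subtype ∘ₗ DirectSum.component ℝ ℤ (fun i => M.deg i) j ∘ₗ
    (auxEquiv M).symm.toLinearMap

lemma auxProj_mem (M : GAMod V) (j : ℤ) (x : M.M) : auxProj M j x ∈ M.deg j :=
  Subtype.prop _

lemma auxProj_of_mem (M : GAMod V) (i j : ℤ) {x : M.M} (hx : x ∈ M.deg i) :
    auxProj M j x = if i = j then x else 0 := by
  have h : (auxEquiv M).symm x
      = DirectSum.lof ℝ ℤ (fun i => M.deg i) i ⟨x, hx⟩ := by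
    rw [LinearEquiv.symm_apply_eq]
    exact (DirectSum.coeLinearMap_lof M.deg i ⟨x, hx⟩).symm
  simp only [auxProj, LinearMap.comp_apply, LinearEquiv.coe_coe, h]
  by_cases hij : i = j
  · subst hij
    simp [DirectSum.component.lof_self]
  · rw [DirectSum.component.of]
    simp [hij]

lemma aux_grade_induction (M : GAMod V) {p : M.M → Prop} (x : M.M)
    (h0 : p 0) (hm : ∀ i, ∀ y ∈ M.deg i, p y) (ha : ∀ y z, p y → p z → p (y + z)) : p x := by
  have hx : x ∈ ⨆ i, M.deg i := by
    rw [M.internal.submodule_iSup_eq_top]; trivial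
  exact Submodule.iSup_induction M.deg (motive := p) hx hm h0 ha

/-- If all components of `x` lie in a real submodule, so does `x`. -/
lemma aux_mem_of_proj (M : GAMod V) (N : Submodule ℝ M.M) (x : M.M)
    (h : ∀ j, auxProj M j x ∈ N) : x ∈ N := by
  have hx : DirectSum.coeLinearMap M.deg
      ((auxEquiv M).symm x) = x :=
    LinearEquiv.apply_symm_apply
      (auxEquiv M) x
  rw [← hx, DirectSum.coeLinearMap_eq_dfinsuppSum, DFinsupp.sum]
  exact Submodule.sum_mem _ fun j _ => h j

lemma aux_finite_proj (M : GAMod V) (x : M.M) :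
    ∃ p : ℤ, ∀ j ≤ p, auxProj M j x = 0 := by
  refine aux_grade_induction M (p := fun x => ∃ p : ℤ, ∀ j ≤ p, auxProj M j x = 0) x ⟨0, fun j _ => map_zero _⟩ (fun i y hy => ⟨i - 1, fun j hj => ?_⟩) ?_
  · rw [auxProj_of_mem M i j hy, if_neg (by omega)]
  · rintro y z ⟨p, hp⟩ ⟨q, hq⟩
    refine ⟨min p q, fun j hj => ?_⟩
    rw [map_add, hp j (by omega), hq j (by omega), add_zero]

lemma aux_smul_deg (M : GAMod V) {k : ℕ} {f : PolyRing V} (hf : f ∈ AdegN V k) {i : ℤ}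
    {z : M.M} (hz : z ∈ M.deg i) : f • z ∈ M.deg (2 * k + i) := by
  refine M.smul_deg _ _ f ?_ z hz
  exact Submodule.mem_iSup_of_mem k (Submodule.mem_iSup_of_mem rfl hf)

lemma aux_proj_smul (M : GAMod V) {k : ℕ} {f : PolyRing V} (hf : f ∈ AdegN V k) (z : M.M) (j : ℤ) :
    auxProj M j (f • z) = f • auxProj M (j - 2 * k) z := by
  refine aux_grade_induction M (p := fun z => auxProj M j (f • z) = f • auxProj M (j - 2 * k) z)
    z (by simp) (fun i y hy => ?_) ?_
  · rw [auxProj_of_mem M _ _ hy, auxProj_of_mem M _ _ (aux_smul_deg M hf hy)]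
    by_cases h : i = j - 2 * k
    · rw [if_pos h, if_pos (by omega)]
    · rw [if_neg h, if_neg (by omega), smul_zero]
  · intro y z hy hz
    rw [smul_add, map_add, map_add, smul_add, hy, hz]

/-- If components of `z` in degrees `≤ q` lie in the `A`-submodule `N` and `f` has no constant
term then components of `f • z` in degrees `≤ q + 1` lie in `N`. -/
lemma aux_proj_pos (M : GAMod V) (N : Submodule (PolyRing V) M.M) {f : PolyRing V}
    (hf : f ∈ auxPos V) (z : M.M) (q : ℤ) (hz : ∀ j ≤ q, auxProj M j z ∈ N) :
    ∀ j ≤ q + 1, auxProj M j (f • z) ∈ N := by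
  intro j hj
  unfold auxPos at hf
  induction hf using Submodule.iSup_induction' with
  | mem i x hx =>
    rw [aux_proj_smul M hx]
    refine N.smul_mem _ (hz _ ?_)
    push_cast
    omega
  | zero => simp
  | add x y _ _ h1 h2 => rw [add_smul, map_add]; exact add_mem h1 h2

lemma aux_algebraMap_smul (M : GAMod V) (r : ℝ) (x : M.M) :
    algebraMap ℝ (PolyRing V) r • x = r • x := algebraMap_smul _ _ _

/-- graded Nakayama -/
lemma aux_nakayama (M : GAMod V) (b e : M.M) (hb : ∀ x : M.M, ∃ a : PolyRing V, x = a • b)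
    (he : e ∈ M.deg 0)
    (hgen : ∀ x : M.M, ∃ r : ℝ, x - r • e ∈ mSub V M.M) :
    ∀ x : M.M, ∃ a : PolyRing V, x = a • e := by
  set N : Submodule (PolyRing V) M.M := Submodule.span (PolyRing V) {e} with hN
  have heN : e ∈ N := Submodule.mem_span_singleton_self e
  obtain ⟨p, hp⟩ := aux_finite_proj M b
  have key : ∀ n : ℕ, ∀ x : M.M, ∀ j ≤ p + n, auxProj M j x ∈ N := by
    intro n
    induction n with
    | zero =>
      intro x j hj
      obtain ⟨a, rfl⟩ := hb x
      obtain ⟨w, hw, hw'⟩ := aux_decomp a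
      rw [hw', add_smul, map_add, aux_algebraMap_smul, map_smul, hp j (by simpa using hj),
        smul_zero, zero_add]
      refine aux_proj_pos M N hw b p ?_ j (by simp at hj; omega)
      intro j hj
      rw [hp j hj]; exact zero_mem _
    | succ n ih =>
      intro x j hj
      obtain ⟨r, hr⟩ := hgen x
      have h1 : auxProj M j (x - r • e) ∈ N := by
        unfold mSub at hr
        refine Submodule.smul_induction_on hr ?_ ?_
        · intro f hf z _
          obtain ⟨w, hw, hw'⟩ := aux_decomp f
          rw [aux_mem_mId.mp hf, map_zero, zero_add] at hw'
          rw [hw']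
          exact aux_proj_pos M N hw z (p + n) (ih z) j (by push_cast at hj; omega)
        · intro y z hy hz
          rw [map_add]; exact add_mem hy hz
      have h2 : auxProj M j (r • e) ∈ N := by
        rw [map_smul, auxProj_of_mem M 0 j he]
        rw [← aux_algebraMap_smul]
        refine N.smul_mem _ ?_
        split_ifs
        · exact heN
        · exact zero_mem _
      have := add_mem h1 h2
      rwa [← map_add, sub_add_cancel] at this
  intro x
  have hx : x ∈ N.restrictScalars ℝ := by
    refine aux_mem_of_proj M _ x fun j => ?_
    exact key (j - p).toNat x j (by omega)
  obtain ⟨a, ha⟩ := Submodule.mem_span_singleton.mp hx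
  exact ⟨a, ha.symm⟩

/-- A free module with one-dimensional reduction is cyclic. -/
lemma aux_rank_one {τ : Cone V} (h0 : (0 : V) ∈ τ.carrier) (M : GAMod V)
    (hfree : FreeOverCone V τ M.M) (e : M.M)
    (hne : e ≠ 0)
    (hgen : ∀ x : M.M, ∃ r : ℝ, x - r • e ∈ mSub V M.M) :
    ∃ b : M.M, (∀ x : M.M, ∃ a : PolyRing V, x = a • b) ∧
      ∀ a : PolyRing V, a • b = 0 → a ∈ vanishingIdeal V τ.carrier := by
  obtain ⟨ht, hfr⟩ := hfree
  let _ := ht.module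
  have hsm : ∀ (a : PolyRing V) (x : M.M),
      (Ideal.Quotient.mk (vanishingIdeal V τ.carrier) a) • x = a • x := fun a x => rfl
  obtain ⟨ι, B⟩ := Module.Free.exists_basis (coneRing V τ) M.M
  let ev : coneRing V τ →+* ℝ := Ideal.Quotient.lift _ (evalRH V 0) (fun a ha =>
    aux_mem_vanishing.mp ha 0 h0)
  have hev : ∀ a : PolyRing V, ev (Ideal.Quotient.mk _ a) = a.1 0 := fun a => rfl
  have hkill : ∀ i, ∀ x ∈ mSub V M.M, ev (B.repr x i) = 0 := by
    intro i x hx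
    unfold mSub at hx
    refine Submodule.smul_induction_on hx ?_ ?_
    · intro f hf z _
      rw [← hsm, map_smul, Finsupp.smul_apply, smul_eq_mul, map_mul, hev, aux_mem_mId.mp hf,
        zero_mul]
    · intro y z hy hz
      rw [map_add, Finsupp.add_apply, map_add, hy, hz, add_zero]
  have hphi : ∀ x, ∃ r : ℝ, ∀ i, ev (B.repr x i) = r * ev (B.repr e i) := by
    intro x
    obtain ⟨r, hr⟩ := hgen x
    refine ⟨r, fun i => ?_⟩
    have := hkill i _ hr
    rw [← aux_algebraMap_smul, ← hsm, map_sub, map_smul, Finsupp.sub_apply, map_sub,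
      Finsupp.smul_apply, smul_eq_mul, map_mul, hev] at this
    exact sub_eq_zero.mp this
  have hsub : ∀ i j : ι, i = j := by
    intro i j
    by_contra hij
    obtain ⟨r, hr⟩ := hphi (B i)
    obtain ⟨r', hr'⟩ := hphi (B j)
    have h1 := hr i
    have h2 := hr' i
    have h3 := hr' j
    simp only [Basis.repr_self, Finsupp.single_apply, if_true, if_neg (Ne.symm hij), map_one,
      map_zero] at h1 h2 h3
    rcases mul_eq_zero.mp h2.symm with h | h
    · rw [h, zero_mul] at h3; exact one_ne_zero h3
    · rw [h, mul_zero] at h1; exact one_ne_zero h1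
  have hnon : Nonempty ι := by
    by_contra hemp
    rw [not_nonempty_iff] at hemp
    exact hne (B.ext_elem fun i => hemp.elim i)
  obtain ⟨i⟩ := hnon
  refine ⟨B i, fun x => ?_, fun a ha => ?_⟩
  · obtain ⟨a, ha⟩ := Ideal.Quotient.mk_surjective (B.repr x i)
    refine ⟨a, ?_⟩
    rw [← hsm, ha]
    apply B.ext_elem
    intro j
    obtain rfl := hsub i j
    simp
  · rw [← hsm] at ha
    have : B.repr ((Ideal.Quotient.mk (vanishingIdeal V τ.carrier) a) • B i) i = 0 := by
      rw [ha]; simp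
    rw [map_smul, Finsupp.smul_apply, Basis.repr_self, Finsupp.single_eq_same, smul_eq_mul,
      mul_one] at this
    exact Ideal.Quotient.eq_zero_iff_mem.mp this

/-! ### sheaves -/

variable {Δ : Fan V} (F : FanSheaf Δ)

/-- `e` is a free degree-zero generator of the stalk at `τ`, restricting to `e0`. -/
def auxP (e0 : (F.stalk Δ.ozero).M) (τ : Δ.cones) (e : (F.stalk τ).M) : Prop :=
  e ∈ (F.stalk τ).deg 0 ∧ (∀ x : (F.stalk τ).M, ∃ a : PolyRing V, x = a • e) ∧
  (∀ a : PolyRing V, a • e = 0 ↔ a ∈ vanishingIdeal V τ.1.carrier) ∧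
  ∀ h : Cone.IsFaceOf Δ.ozero.1 τ.1, (F.res τ Δ.ozero h).toLin e = e0

variable {F}

lemma aux_smul_o (hN : F.CondN) (a : PolyRing V) (x : (F.stalk Δ.ozero).M) :
    a • x = a.1 0 • x := by
  rw [← aux_algebraMap_smul]
  rw [← sub_eq_zero, ← sub_smul]
  have hm : a - algebraMap ℝ (PolyRing V) (a.1 0) ∈ mId V := by
    rw [aux_mem_mId]
    change a.1 0 - a.1 0 = 0
    exact sub_self _
  have htor := hN.1
  exact @htor x ⟨_, hm⟩

lemma aux_mSub_o (hN : F.CondN) {x : (F.stalk Δ.ozero).M} (hx : x ∈ mSub V (F.stalk Δ.ozero).M) :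
    x = 0 := by
  unfold mSub at hx
  refine Submodule.smul_induction_on hx ?_ ?_
  · intro f hf z _
    rw [aux_smul_o hN, aux_mem_mId.mp hf, zero_smul]
  · rintro y z rfl rfl
    simp

lemma aux_exists_e0 (hN : F.CondN) :
    ∃ e0 : (F.stalk Δ.ozero).M, e0 ≠ 0 ∧ e0 ∈ (F.stalk Δ.ozero).deg 0 ∧
      ∀ x : (F.stalk Δ.ozero).M, ∃ r : ℝ, x = r • e0 := by
  obtain ⟨e0, h0, h1⟩ := finrank_eq_one_iff'.mp hN.2.1
  refine ⟨e0, h0, ?_, fun x => (h1 x).imp fun r hr => hr.symm⟩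
  refine aux_grade_induction _ (p := fun x => x ∈ (F.stalk Δ.ozero).deg 0) e0 (zero_mem _)
    (fun i y hy => ?_) (fun y z hy hz => add_mem hy hz)
  by_cases hi : i = 0
  · rwa [hi] at hy
  · rw [hN.2.2 i hi, Submodule.mem_bot] at hy
    rw [hy]; exact zero_mem _

lemma aux_uniq (hN : F.CondN) {e0 : (F.stalk Δ.ozero).M} (he0 : e0 ≠ 0) {τ : Δ.cones}
    (h : Cone.IsFaceOf Δ.ozero.1 τ.1) {e : (F.stalk τ).M} (he : auxP F e0 τ e)
    {x : (F.stalk τ).M} (hx : x ∈ (F.stalk τ).deg 0)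
    (hx0 : (F.res τ Δ.ozero h).toLin x = e0) : x = e := by
  obtain ⟨h1, h2, h3, h4⟩ := he
  obtain ⟨a, rfl⟩ := h2 x
  rw [map_smul, h4 h, aux_smul_o hN] at hx0
  have ha : a.1 0 = 1 := by
    have : (a.1 0 - 1) • e0 = 0 := by rw [sub_smul, hx0, one_smul, sub_self]
    rcases smul_eq_zero.mp this with h | h
    · linarith
    · exact absurd h he0
  obtain ⟨w, hw, hw'⟩ := aux_decomp a
  rw [ha, map_one] at hw'
  have hx' : auxProj _ 0 (a • e) = a • e := by rw [auxProj_of_mem _ 0 0 hx, if_pos rfl]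
  have hwe : auxProj (F.stalk τ) 0 (w • e) ∈ (⊥ : Submodule (PolyRing V) (F.stalk τ).M) := by
    refine aux_proj_pos _ ⊥ hw e (-1) (fun j hj => ?_) 0 (by norm_num)
    rw [auxProj_of_mem _ 0 j h1, if_neg (by omega)]
    exact zero_mem _
  rw [Submodule.mem_bot] at hwe
  rw [← hx', hw', add_smul, one_smul, map_add, hwe, add_zero, auxProj_of_mem _ 0 0 h1, if_pos rfl]

/-- the vanishing face -/
lemma aux_zero_face {τ : Δ.cones} {t : Finset V}
    (ht : LinearIndependent ℝ (fun v : t => (v : V))) (hτ : τ.1.carrier = coneGen t) :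
    Cone.IsFaceOf Δ.ozero.1 τ.1 := by
  refine aux_subset_face (Finset.empty_subset t) ht hτ ?_
  change ({0} : Set V) = _
  ext x; simp [coneGen]

lemma aux_proper_face {υ τ : Cone V} {t : Finset V} (hτ : τ.carrier = coneGen t)
    (h : υ.IsProperFaceOf τ) :
    ∃ t' ⊂ t, υ.carrier = coneGen t' := by
  obtain ⟨⟨f, hf, hυ⟩, hne⟩ := h
  rw [hτ] at hf hυ
  rw [aux_face f hf] at hυ
  refine ⟨_, ?_, hυ⟩
  refine (Finset.filter_subset _ _).ssubset_of_ne fun heq => hne (aux_cone_ext ?_)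
  rw [hυ, hτ, heq]

/-- Generator of the module of sections on the boundary fan. -/
lemma aux_boundary (hN : F.CondN) {e0 : (F.stalk Δ.ozero).M} (he0 : e0 ≠ 0)
    {τ : Δ.cones} (hτ0 : τ.1 ≠ zeroCone V) {t : Finset V}
    (ht : LinearIndependent ℝ (fun v : t => (v : V))) (hτ : τ.1.carrier = coneGen t)
    (ih : ∀ υ : Δ.cones, Cone.IsProperFaceOf υ.1 τ.1 → ∃ e, auxP F e0 υ e) :
    ∃ s0 : F.Sec (FanSheaf.bdFan τ), s0 ∈ F.secDeg (FanSheaf.bdFan τ) 0 ∧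
      (∀ s : F.Sec (FanSheaf.bdFan τ), ∃ a : PolyRing V, s = a • s0) ∧
      s0.1 Δ.ozero = e0 := by
  have hoface : Cone.IsProperFaceOf Δ.ozero.1 τ.1 :=
    ⟨aux_zero_face ht hτ, fun h => hτ0 h.symm⟩
  choose! e he using ih
  have hof : ∀ υ : Δ.cones, Cone.IsProperFaceOf υ.1 τ.1 → Cone.IsFaceOf Δ.ozero.1 υ.1 := by
    intro υ hυ
    obtain ⟨t', ht', hc⟩ := aux_proper_face hτ hυ
    exact aux_zero_face (aux_li_mono ht'.1 ht) hc
  have hcomp : ∀ υ ω : Δ.cones, Cone.IsProperFaceOf υ.1 τ.1 → Cone.IsProperFaceOf ω.1 τ.1 →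
      ∀ h : Cone.IsFaceOf ω.1 υ.1, (F.res υ ω h).toLin (e υ) = e ω := by
    intro υ ω hυ hω h
    refine aux_uniq hN he0 (hof ω hω) (he ω hω) ((F.res υ ω h).deg_mem _ _ (he υ hυ).1) ?_
    have := F.res_comp υ ω Δ.ozero h (hof ω hω) (hof υ hυ)
    have h2 := LinearMap.congr_fun this (e υ)
    rw [LinearMap.comp_apply] at h2
    rw [h2]
    exact (he υ hυ).2.2.2 _
  let s0 : F.Sec (FanSheaf.bdFan τ) :=
    ⟨fun υ => if Cone.IsProperFaceOf υ.1 τ.1 then e υ else 0, by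
      refine ⟨fun υ hυ => if_neg hυ, fun υ ω hυ hω h => ?_⟩
      have hυ' : Cone.IsProperFaceOf υ.1 τ.1 := hυ
      have hω' : Cone.IsProperFaceOf ω.1 τ.1 := hω
      dsimp only
      rw [if_pos hυ', if_pos hω']
      exact hcomp υ ω hυ hω h⟩
  have hs0 : ∀ υ : Δ.cones, Cone.IsProperFaceOf υ.1 τ.1 → s0.1 υ = e υ :=
    fun υ hυ => if_pos hυ
  refine ⟨s0, ?_, ?_, ?_⟩
  · intro υ
    by_cases hυ : Cone.IsProperFaceOf υ.1 τ.1
    · rw [hs0 υ hυ]; exact (he υ hυ).1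
    · have : s0.1 υ = 0 := if_neg hυ
      rw [this]; exact zero_mem _
  · intro s
    -- the facets
    have hfacet : ∀ t' ⊂ t, ∃ υ : Δ.cones, υ.1.carrier = coneGen t' ∧
        Cone.IsProperFaceOf υ.1 τ.1 := by
      intro t' ht'
      let C := auxSub τ.1 t t' hτ ht'.1
      have hC : C.IsFaceOf τ.1 := aux_subset_face ht'.1 ht hτ rfl
      refine ⟨⟨C, Δ.face_mem τ.1 τ.2 C hC⟩, rfl, hC, fun hCτ => ?_⟩
      have hcar : coneGen t' = coneGen t := by
        rw [← hτ]; exact congrArg Cone.carrier hCτ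
      obtain ⟨v, hvt, hvt'⟩ := Finset.exists_of_ssubset ht'
      have hv : v ∈ coneGen t' := hcar ▸ aux_mem_coneGen hvt
      obtain ⟨f, hf⟩ := aux_exists_lin ht (fun w => if w = v then (1 : ℝ) else 0)
      obtain ⟨c, hc, hvc⟩ := hv
      have h1 : f v = 1 := by rw [hf v hvt]; simp
      have h2 : f v = 0 := by
        rw [hvc, map_sum]
        refine Finset.sum_eq_zero fun w hw => ?_
        rw [map_smul, hf w (ht'.1 hw), if_neg (by rintro rfl; exact hvt' hw), smul_zero]
      rw [h1] at h2
      exact one_ne_zero h2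
    have ha : ∀ υ : Δ.cones, Cone.IsProperFaceOf υ.1 τ.1 → ∃ a : PolyRing V, s.1 υ = a • e υ :=
      fun υ hυ => (he υ hυ).2.1 (s.1 υ)
    choose! α hα using ha
    have hagree : ∀ υ ω : Δ.cones, Cone.IsProperFaceOf υ.1 τ.1 → Cone.IsProperFaceOf ω.1 τ.1 →
        Cone.IsFaceOf ω.1 υ.1 → ∀ x ∈ ω.1.carrier, (α υ).1 x = (α ω).1 x := by
      intro υ ω hυ hω h x hx
      have h1 := s.2.2 υ ω hυ hω h
      rw [hα υ hυ, hα ω hω, map_smul, hcomp υ ω hυ hω h, ← sub_eq_zero, ← sub_smul,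
        (he ω hω).2.2.1, aux_mem_vanishing] at h1
      exact sub_eq_zero.mp (h1 x hx)
    have hfac : ∀ v : V, ∃ υ : Δ.cones, v ∈ t → υ.1.carrier = coneGen (t.erase v) ∧
        Cone.IsProperFaceOf υ.1 τ.1 := by
      intro v
      by_cases hv : v ∈ t
      · obtain ⟨υ, h⟩ := hfacet (t.erase v) (Finset.erase_ssubset hv)
        exact ⟨υ, fun _ => h⟩
      · exact ⟨τ, fun h => absurd h hv⟩
    choose φ hφ using hfac
    obtain ⟨a, ha⟩ := aux_extend ht (fun v => α (φ v)) (by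
      intro v hv w hw x hx
      have hss : (t.erase v).erase w ⊂ t :=
        lt_of_le_of_lt (Finset.erase_subset _ _) (Finset.erase_ssubset hv)
      obtain ⟨ω, hω, hωp⟩ := hfacet _ hss
      have hxω : x ∈ ω.1.carrier := by rw [hω]; exact hx
      have f1 : Cone.IsFaceOf ω.1 (φ v).1 := aux_subset_face (Finset.erase_subset _ _)
        (aux_li_mono (Finset.erase_subset _ _) ht) (hφ v hv).1 hω
      have f2 : Cone.IsFaceOf ω.1 (φ w).1 := aux_subset_face
        (by rw [Finset.erase_right_comm]; exact Finset.erase_subset _ _)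
        (aux_li_mono (Finset.erase_subset _ _) ht) (hφ w hw).1 hω
      change (α (φ v)).1 x = (α (φ w)).1 x
      rw [hagree _ _ (hφ v hv).2 hωp f1 x hxω, hagree _ _ (hφ w hw).2 hωp f2 x hxω]) t subset_rfl
    refine ⟨a, Subtype.ext (funext fun υ => ?_)⟩
    change s.1 υ = a • s0.1 υ
    by_cases hυ : Cone.IsProperFaceOf υ.1 τ.1
    · rw [hs0 υ hυ, hα υ hυ, ← sub_eq_zero, ← sub_smul, (he υ hυ).2.2.1, aux_mem_vanishing]
      intro x hx
      obtain ⟨t', ht', hc⟩ := aux_proper_face hτ hυ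
      obtain ⟨v, hvt, hvt'⟩ := Finset.exists_of_ssubset ht'
      have hsub : t' ⊆ t.erase v := fun w hw =>
        Finset.mem_erase.mpr ⟨fun h => hvt' (h ▸ hw), ht'.1 hw⟩
      have f1 : Cone.IsFaceOf υ.1 (φ v).1 := aux_subset_face hsub
        (aux_li_mono (Finset.erase_subset _ _) ht) (hφ v hvt).1 hc
      have h1 := hagree _ _ (hφ v hvt).2 hυ f1 x hx
      have h2 := ha v hvt x (aux_coneGen_mono hsub (hc ▸ hx))
      change (α υ).1 x - a.1 x = 0
      rw [← h1, h2, sub_self]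
    · have h1 : s0.1 υ = 0 := if_neg hυ
      rw [h1, smul_zero]
      exact s.2.1 υ hυ
  · rw [hs0 _ hoface]
    have h1 := (he _ hoface).2.2.2 (hof _ hoface)
    rwa [F.res_self, LinearMap.id_apply] at h1

/-- The consequences of (LME). -/
lemma aux_step (hF : F.IsMES) {e0 : (F.stalk Δ.ozero).M} (he0 : e0 ≠ 0)
    {τ : Δ.cones} (hτ0 : τ.1 ≠ zeroCone V) {t : Finset V}
    (ht : LinearIndependent ℝ (fun v : t => (v : V))) (hτ : τ.1.carrier = coneGen t)
    (ih : ∀ υ : Δ.cones, Cone.IsProperFaceOf υ.1 τ.1 → ∃ e, auxP F e0 υ e) :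
    ∃ e ∈ (F.stalk τ).deg 0,
      (∀ h : Cone.IsFaceOf Δ.ozero.1 τ.1, (F.res τ Δ.ozero h).toLin e = e0) ∧
      e ∉ mSub V (F.stalk τ).M ∧
      (∀ q : ℤ, q ≠ 0 → ∀ x ∈ (F.stalk τ).deg q, x ∈ mSub V (F.stalk τ).M) ∧
      (∀ x ∈ (F.stalk τ).deg 0, ∃ r : ℝ, x - r • e ∈ mSub V (F.stalk τ).M) := by
  obtain ⟨hN, hPF, hLME⟩ := hF
  have hoface : Cone.IsProperFaceOf Δ.ozero.1 τ.1 :=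
    ⟨aux_zero_face ht hτ, fun h => hτ0 h.symm⟩
  obtain ⟨s0, hs0, hgen, hs0o⟩ := aux_boundary hN he0 hτ0 ht hτ ih
  -- evaluation of sections at `o`
  let ev : F.Sec (FanSheaf.bdFan τ) →ₗ[PolyRing V] (F.stalk Δ.ozero).M :=
    (LinearMap.proj Δ.ozero).comp (F.secSub (FanSheaf.bdFan τ)).subtype
  have hev : ∀ s, ev s = s.1 Δ.ozero := fun s => rfl
  have hevm : ∀ s ∈ mSub V (F.Sec (FanSheaf.bdFan τ)), s.1 Δ.ozero = 0 := by
    intro s hs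
    exact aux_mSub_o hN (mSub_le_comap V ev hs)
  have hbd : ∀ x, (F.bdRes τ x).1 Δ.ozero = (F.res τ Δ.ozero hoface.1).toLin x :=
    fun x => dif_pos hoface
  have hred : ∀ x, F.bdResRed τ ((mSub V (F.stalk τ).M).mkQ x)
      = (mSub V (F.Sec (FanSheaf.bdFan τ))).mkQ (F.bdRes τ x) := fun x => rfl
  have hs0m : (mSub V (F.Sec (FanSheaf.bdFan τ))).mkQ s0 ∈
      mRedPiece V (M := F.Sec (FanSheaf.bdFan τ)) (F.secDeg (FanSheaf.bdFan τ) 0) :=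
    ⟨s0, hs0, rfl⟩
  obtain ⟨y, ⟨e, he, rfl⟩, hy⟩ := (hLME τ hτ0 0).surjOn hs0m
  have hy' : (mSub V (F.Sec (FanSheaf.bdFan τ))).mkQ (F.bdRes τ e)
      = (mSub V (F.Sec (FanSheaf.bdFan τ))).mkQ s0 := hy
  have hres : ∀ h : Cone.IsFaceOf Δ.ozero.1 τ.1, (F.res τ Δ.ozero h).toLin e = e0 := by
    intro h
    have h1 := hevm _ ((Submodule.Quotient.eq _).mp hy')
    have h2 : (F.bdRes τ e).1 Δ.ozero - s0.1 Δ.ozero = 0 := h1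
    rw [hbd, hs0o] at h2
    exact sub_eq_zero.mp h2
  have hmain : ∀ q : ℤ, ∀ x ∈ (F.stalk τ).deg q, ∃ r : ℝ, (q ≠ 0 → r = 0) ∧
      x - r • e ∈ mSub V (F.stalk τ).M := by
    intro q x hx
    have hxm : (mSub V (F.stalk τ).M).mkQ x ∈ mRedPiece V ((F.stalk τ).deg q) := ⟨x, hx, rfl⟩
    obtain ⟨s, hs, hsx⟩ := (hLME τ hτ0 q).mapsTo hxm
    have hsx' : (mSub V (F.Sec (FanSheaf.bdFan τ))).mkQ s
      = (mSub V (F.Sec (FanSheaf.bdFan τ))).mkQ (F.bdRes τ x) := hsx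
    obtain ⟨a, rfl⟩ := hgen s
    have hq : q ≠ 0 → a.1 0 = 0 := by
      intro hq
      have h1 : a • s0.1 Δ.ozero ∈ (F.stalk Δ.ozero).deg q := hs Δ.ozero
      rw [hN.2.2 q hq, Submodule.mem_bot, hs0o, aux_smul_o hN] at h1
      exact (smul_eq_zero.mp h1).resolve_right he0
    have hre : a.1 0 • e ∈ (F.stalk τ).deg q := by
      by_cases hq0 : q = 0
      · rw [hq0]; exact Submodule.smul_mem _ _ he
      · rw [hq hq0, zero_smul]; exact zero_mem _
    refine ⟨a.1 0, hq, ?_⟩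
    have hrem : (mSub V (F.stalk τ).M).mkQ (a.1 0 • e) ∈ mRedPiece V ((F.stalk τ).deg q) :=
      ⟨_, hre, rfl⟩
    have hinj := (hLME τ hτ0 q).injOn hxm hrem ?_
    · exact (Submodule.Quotient.eq _).mp hinj
    · have h5 : (mSub V (F.Sec (FanSheaf.bdFan τ))).mkQ (F.bdRes τ (a.1 0 • e)) =
          (mSub V (F.Sec (FanSheaf.bdFan τ))).mkQ (algebraMap ℝ (PolyRing V) (a.1 0) • s0) := by
        rw [← aux_algebraMap_smul, map_smul (F.bdRes τ), map_smul (Submodule.mkQ _), hy',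
          ← map_smul]
      rw [hred, hred, ← hsx', h5]
      refine (Submodule.Quotient.eq _).mpr ?_
      rw [← sub_smul]
      refine Submodule.smul_mem_smul ?_ trivial
      change a.1 0 - a.1 0 = 0
      exact sub_self _
  refine ⟨e, he, hres, ?_, ?_, ?_⟩
  · intro hm
    have := aux_mSub_o hN (mSub_le_comap V (F.res τ Δ.ozero hoface.1).toLin hm)
    rw [hres] at this
    exact he0 this
  · intro q hq x hx
    obtain ⟨r, hr, hr'⟩ := hmain q x hx
    rw [hr hq, zero_smul, sub_zero] at hr'
    exact hr'
  · intro x hx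
    obtain ⟨r, -, hr'⟩ := hmain 0 x hx
    exact ⟨r, hr'⟩

lemma aux_all (hF : F.IsMES) {e0 : (F.stalk Δ.ozero).M} (he0 : e0 ≠ 0)
    (he0d : e0 ∈ (F.stalk Δ.ozero).deg 0) (he0g : ∀ x, ∃ r : ℝ, x = r • e0)
    (t : Finset V) : ∀ (τ : Δ.cones), LinearIndependent ℝ (fun v : t => (v : V)) →
      τ.1.carrier = coneGen t → ∃ e, auxP F e0 τ e := by
  induction t using Finset.strongInduction with
  | H t ih =>
  intro τ ht hτ
  by_cases hτ0 : τ.1 = zeroCone V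
  · obtain rfl : τ = Δ.ozero := Subtype.ext hτ0
    refine ⟨e0, he0d, fun x => ?_, fun a => ?_, fun h => ?_⟩
    · obtain ⟨r, hr⟩ := he0g x
      exact ⟨algebraMap ℝ _ r, by rw [aux_algebraMap_smul]; exact hr⟩
    · rw [aux_smul_o hF.1, aux_mem_vanishing, smul_eq_zero, or_iff_left he0]
      constructor
      · intro h x hx
        have : x = 0 := hx
        rw [this, h]
      · intro h
        exact h 0 rfl
    · rw [F.res_self, LinearMap.id_apply]
  · obtain ⟨e, he, hres, hem, hq, h0⟩ := aux_step hF he0 hτ0 ht hτ (fun υ hυ => by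
      obtain ⟨t', ht', hc⟩ := aux_proper_face hτ hυ
      exact ih t' ht' υ (aux_li_mono ht'.1 ht) hc)
    have hgen : ∀ x : (F.stalk τ).M, ∃ r : ℝ, x - r • e ∈ mSub V (F.stalk τ).M := by
      intro x
      refine aux_grade_induction _ (p := fun x => ∃ r : ℝ, x - r • e ∈ mSub V (F.stalk τ).M) x
        ⟨0, by simp⟩ (fun i y hy => ?_) ?_
      · by_cases hi : i = 0
        · subst hi; exact h0 y hy
        · exact ⟨0, by rw [zero_smul, sub_zero]; exact hq i hi y hy⟩
      · rintro y z ⟨r, hr⟩ ⟨r', hr'⟩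
        refine ⟨r + r', ?_⟩
        have := add_mem hr hr'
        rwa [sub_add_sub_comm, ← add_smul] at this
    have hne : e ≠ 0 := fun h => hem (h ▸ zero_mem _)
    obtain ⟨b, hb, hbann⟩ := aux_rank_one (hτ ▸ aux_zero_mem t) (F.stalk τ) (hF.2.1 τ) e hne hgen
    have hcyc := aux_nakayama (F.stalk τ) b e hb he hgen
    refine ⟨e, he, hcyc, fun a => ⟨fun ha => hbann a ?_, fun ha => ?_⟩, hres⟩
    · obtain ⟨c, rfl⟩ := hcyc b
      rw [smul_comm, ha, smul_zero]
    · obtain ⟨htor, -⟩ := hF.2.1 τ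
      exact @htor e ⟨a, ha⟩

end Aux

/-- For a non-zero simplicial cone `σ`, the local Poincaré polynomial is `P_σ ≡ 1`,
i.e. `Ē•_σ` is one-dimensional and concentrated in degree `0`. -/
theorem localP_of_simplicial_cone
    {V : Type} [AddCommGroup V] [Module ℝ V] [FiniteDimensional ℝ V]
    {σ : Cone V} (hσ : σ.IsSimplicial) (hσ0 : σ ≠ zeroCone V)
    {Δ : Fan V} (hΔ : Δ.cones = {τ : Cone V | τ.IsFaceOf σ}) (hmem : σ ∈ Δ.cones)
    (F : FanSheaf Δ) (hF : F.IsMES) :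
    F.localP ⟨σ, hmem⟩ = 1 ∧
    Module.finrank ℝ (mRedPiece V ((F.stalk ⟨σ, hmem⟩).deg 0)) = 1 ∧
    ∀ q : ℤ, q ≠ 0 → mRedPiece V ((F.stalk ⟨σ, hmem⟩).deg q) = ⊥ := by
  obtain ⟨t, ht, hσt⟩ := hσ
  obtain ⟨e0, he0, he0d, he0g⟩ := aux_exists_e0 hF.1
  obtain ⟨e, he, -, hem, hq, h0⟩ := aux_step (τ := ⟨σ, hmem⟩) hF he0 hσ0 ht hσt (fun υ hυ => by
    obtain ⟨t', ht', hc⟩ := aux_proper_face hσt hυ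
    exact aux_all hF he0 he0d he0g t' υ (aux_li_mono ht'.1 ht) hc)
  have hbot : ∀ q : ℤ, q ≠ 0 → mRedPiece V ((F.stalk ⟨σ, hmem⟩).deg q) = ⊥ := by
    intro q hq0
    rw [eq_bot_iff]
    rintro _ ⟨x, hx, rfl⟩
    exact (Submodule.Quotient.mk_eq_zero _).mpr (hq q hq0 x hx)
  have hone : Module.finrank ℝ (mRedPiece V ((F.stalk ⟨σ, hmem⟩).deg 0)) = 1 := by
    have hspan : mRedPiece V ((F.stalk ⟨σ, hmem⟩).deg 0)
        = Submodule.span ℝ {(mSub V (F.stalk ⟨σ, hmem⟩).M).mkQ e} := by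
      apply le_antisymm
      · rintro _ ⟨x, hx, rfl⟩
        obtain ⟨r, hr⟩ := h0 x hx
        rw [Submodule.mem_span_singleton]
        exact ⟨r, ((Submodule.Quotient.eq _).mpr hr).symm⟩
      · rw [Submodule.span_singleton_le_iff_mem]
        exact ⟨e, he, rfl⟩
    rw [hspan]
    refine finrank_span_singleton fun h => hem ?_
    exact (Submodule.Quotient.mk_eq_zero _).mp h
  refine ⟨?_, hone, hbot⟩
  have hd : ∀ q : ℕ, Module.finrank ℝ (mRedPiece V ((F.stalk ⟨σ, hmem⟩).deg q))
      = if q = 0 then 1 else 0 := by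
    intro q
    split_ifs with h
    · subst h; exact hone
    · rw [hbot q (by exact_mod_cast h)]
      exact finrank_bot ℝ _
  unfold FanSheaf.localP
  simp only [hd]
  have hsupp : Function.support (fun q : ℕ => if q = 0 then 1 else 0) = {0} := by
    ext q; simp
  have hfin : (Function.support (fun q : ℕ => if q = 0 then 1 else 0)).Finite := by
    rw [hsupp]; exact Set.finite_singleton 0
  unfold poincareOf
  rw [dif_pos hfin]
  have : hfin.toFinset = {0} := by
    ext q; simp
  rw [this]
  simp
end
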